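/- arXiv:1406.7457 — 2 statements merged into one kernel-verified Lean document; each statement's English description precedes it below -/
import Mathlib

section
/- Let k ≥ 2 be an integer and let v be a P_{k−1} vector field. If ∫_K τ(x) : ε(v)(x) dx = 0 for every τ ∈ Σ_{K,b}, and ∫_K v(x) · r(x) dx = 0 for every rigid motion r, then v = 0 identically on ℝ². -/
open MeasureTheory

noncomputable section

/-- For a column vector `v ∈ ℝ²`, `vvT v` is the rank-one symmetric matrix `v vᵀ`. -/
def vvT (v : Fin 2 → ℝ) : Matrix (Fin 2) (Fin 2) ℝ :=
  Matrix.of fun i j => v i * v j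

/-- For `n = (a, b)`, `perp n = (−b, a)`. -/
def perp (n : Fin 2 → ℝ) : Fin 2 → ℝ := ![-(n 1), n 0]

/-- Frobenius inner product `A : B` of 2×2 matrices. -/
def frob (A B : Matrix (Fin 2) (Fin 2) ℝ) : ℝ :=
  ∑ i : Fin 2, ∑ j : Fin 2, A i j * B i j

/-- Partial derivative in the `i`-th coordinate direction. -/
def pd (i : Fin 2) (f : (Fin 2 → ℝ) → ℝ) : (Fin 2 → ℝ) → ℝ :=
  fun x => fderiv ℝ f x (Pi.single i 1)

/-- Row-wise divergence of a matrix field: `(div τ)_i = ∂τ_{i1}/∂x + ∂τ_{i2}/∂y`. -/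
def matDiv (τ : (Fin 2 → ℝ) → Matrix (Fin 2) (Fin 2) ℝ) : (Fin 2 → ℝ) → Fin 2 → ℝ :=
  fun x i => pd 0 (fun y => τ y i 0) x + pd 1 (fun y => τ y i 1) x

/-- Symmetric gradient `ε(v) = (Dv + (Dv)ᵀ)/2` of a vector field. -/
def symGrad (v : (Fin 2 → ℝ) → Fin 2 → ℝ) : (Fin 2 → ℝ) → Matrix (Fin 2) (Fin 2) ℝ :=
  fun x => Matrix.of fun i j => (pd j (fun y => v y i) x + pd i (fun y => v y j) x) / 2

/-- A rigid motion `(x, y) ↦ (a − by, c + bx)`. -/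
def IsRigidMotion (r : (Fin 2 → ℝ) → Fin 2 → ℝ) : Prop :=
  ∃ a b c : ℝ, ∀ x, r x = ![a - b * x 1, c + b * x 0]

/-- `f : ℝ² → ℝ` is a polynomial function of total degree at most `m`
(the zero space when `m < 0`). -/
def IsPolyDeg (m : ℤ) (f : (Fin 2 → ℝ) → ℝ) : Prop :=
  ∃ p : MvPolynomial (Fin 2) ℝ, (∀ x, f x = MvPolynomial.eval x p) ∧
    ((p.totalDegree : ℤ) ≤ m ∨ p = 0)

/-- `f : ℝ² → ℝ` is an affine function. -/
def IsAffineFn (f : (Fin 2 → ℝ) → ℝ) : Prop :=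
  ∃ (w : Fin 2 → ℝ) (c : ℝ), ∀ x, f x = w 0 * x 0 + w 1 * x 1 + c

/-- The triangle `K` with the given vertices. -/
def Ktri (x0 x1 x2 : Fin 2 → ℝ) : Set (Fin 2 → ℝ) :=
  convexHull ℝ {x0, x1, x2}

/-- The matrix whose columns are `x1 − x0` and `x2 − x0`. -/
def Bmat (x0 x1 x2 : Fin 2 → ℝ) : Matrix (Fin 2) (Fin 2) ℝ :=
  Matrix.of fun i j => if j = 0 then x1 i - x0 i else x2 i - x0 i

/-- `nvec x0 x1 x2 1` and `nvec x0 x1 x2 2` are the rows of `(Bmat x0 x1 x2)⁻¹`,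
and `nvec x0 x1 x2 0 = −n₁ − n₂`. -/
def nvec (x0 x1 x2 : Fin 2 → ℝ) : Fin 3 → Fin 2 → ℝ :=
  ![fun j => -((Bmat x0 x1 x2)⁻¹ 0 j) - (Bmat x0 x1 x2)⁻¹ 1 j,
    fun j => (Bmat x0 x1 x2)⁻¹ 0 j,
    fun j => (Bmat x0 x1 x2)⁻¹ 1 j]

/-- The bubble stress `λ₂λ₀ p₁ n₁⊥(n₁⊥)ᵀ + λ₀λ₁ p₂ n₂⊥(n₂⊥)ᵀ + λ₁λ₂ p₀ n₀⊥(n₀⊥)ᵀ`. -/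
def bubbleStress (x0 x1 x2 : Fin 2 → ℝ) (lam : Fin 3 → (Fin 2 → ℝ) → ℝ)
    (p : Fin 3 → (Fin 2 → ℝ) → ℝ) : (Fin 2 → ℝ) → Matrix (Fin 2) (Fin 2) ℝ :=
  fun x => (lam 2 x * lam 0 x * p 1 x) • vvT (perp (nvec x0 x1 x2 1))
         + (lam 0 x * lam 1 x * p 2 x) • vvT (perp (nvec x0 x1 x2 2))
         + (lam 1 x * lam 2 x * p 0 x) • vvT (perp (nvec x0 x1 x2 0))

/-- Membership in the local bubble stress space `Σ_{K,b}` of order `k`. -/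
def SigmaKb (k : ℕ) (x0 x1 x2 : Fin 2 → ℝ) (lam : Fin 3 → (Fin 2 → ℝ) → ℝ)
    (τ : (Fin 2 → ℝ) → Matrix (Fin 2) (Fin 2) ℝ) : Prop :=
  ∃ p : Fin 3 → (Fin 2 → ℝ) → ℝ,
    (∀ i, IsPolyDeg ((k : ℤ) - 2) (p i)) ∧ τ = bubbleStress x0 x1 x2 lam p

open MvPolynomial in
theorem hasFDerivAt_eval {n : ℕ} (p : MvPolynomial (Fin n) ℝ) (x : Fin n → ℝ) :
    HasFDerivAt (fun y : Fin n → ℝ => eval y p)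
      (∑ i, eval x (pderiv i p) • ContinuousLinearMap.proj (R := ℝ) (φ := fun _ : Fin n => ℝ) i)
      x := by
  induction p using MvPolynomial.induction_on with
  | C a => simpa using hasFDerivAt_const a x
  | add p q hp hq =>
    simp only [map_add, add_smul, Finset.sum_add_distrib]
    exact hp.add hq
  | mul_X p j hp =>
    have hX : HasFDerivAt (fun y : Fin n → ℝ => y j)
        (ContinuousLinearMap.proj (R := ℝ) (φ := fun _ : Fin n => ℝ) j) x :=
      (ContinuousLinearMap.proj (R := ℝ) (φ := fun _ : Fin n => ℝ) j).hasFDerivAt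
    have h := hp.mul hX
    simp only [map_mul, eval_X]
    refine h.congr_fderiv ?_
    ext y
    simp [Finset.sum_add_distrib, add_mul, Finset.mul_sum, pderiv_X, Pi.single_apply, apply_ite]
    ring_nf

open MvPolynomial in
theorem pd_eval (i : Fin 2) (p : MvPolynomial (Fin 2) ℝ) (x : Fin 2 → ℝ) :
    pd i (fun y => eval y p) x = eval x (pderiv i p) := by
  rw [pd, (hasFDerivAt_eval p x).fderiv]
  fin_cases i <;> simp

open MvPolynomial in
theorem eval_eq_of_pderiv_eq_zero {n : ℕ} {p : MvPolynomial (Fin n) ℝ}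
    (h : ∀ i, pderiv i p = 0) (x y : Fin n → ℝ) : eval x p = eval y p := by
  refine is_const_of_fderiv_eq_zero (𝕜 := ℝ) (f := fun y : Fin n → ℝ => eval y p)
    (fun z => (hasFDerivAt_eval p z).differentiableAt) (fun z => ?_) x y
  rw [(hasFDerivAt_eval p z).fderiv]
  simp [h]

open MvPolynomial in
theorem totalDegree_pderiv_le {σ R : Type*} [CommSemiring R] (i : σ) (p : MvPolynomial σ R) :
    (pderiv i p).totalDegree ≤ p.totalDegree - 1 := by
  classical
  refine Finset.sup_le fun m hm => ?_
  have hm' : m + Finsupp.single i 1 ∈ p.support := by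
    rw [mem_support_iff] at hm ⊢
    intro h0
    exact hm (by simp [coeff_pderiv, h0])
  have h := le_totalDegree hm'
  rw [Finsupp.sum_add_index' (by simp) (by simp), Finsupp.sum_single_index rfl] at h
  exact Nat.le_sub_one_of_lt h

open MvPolynomial in
/-- A polynomial that is nonnegative on a compact set with nonempty interior and has zero integral
there vanishes. -/
theorem eq_zero_of_setIntegral_eq_zero {n : ℕ} {s : Set (Fin n → ℝ)} (hs : IsCompact s)
    (hne : (interior s).Nonempty) {p : MvPolynomial (Fin n) ℝ}
    (hp : ∀ x ∈ s, 0 ≤ eval x p) (h : ∫ x in s, eval x p = 0) : p = 0 := by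
  have hcont : Continuous fun x : Fin n → ℝ => eval x p := MvPolynomial.continuous_eval p
  have hae := (setIntegral_eq_zero_iff_of_nonneg_ae
    ((ae_restrict_mem hs.measurableSet).mono fun x hx => hp x hx)
    (hcont.continuousOn.integrableOn_compact hs)).1 h
  have heq := Measure.eqOn_open_of_ae_eq
    (ae_restrict_of_ae_restrict_of_subset interior_subset hae) isOpen_interior
    hcont.continuousOn continuousOn_const
  obtain ⟨z, hz⟩ := hne
  have hfun := (AnalyticOnNhd.eval_mvPolynomial (𝕜 := ℝ) p).eq_of_eventuallyEq
    (g := fun _ => 0) analyticOnNhd_const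
    (Filter.mem_of_superset (isOpen_interior.mem_nhds hz) fun x hx => heq hx)
  exact MvPolynomial.funext fun x => by simpa using congrFun hfun x

open MvPolynomial in
/-- The kernel of the symmetric gradient on polynomial fields consists of rigid motions. -/
theorem isRigidMotion_of_symGrad_eq_zero {q : Fin 2 → MvPolynomial (Fin 2) ℝ}
    (h0 : pderiv 0 (q 0) = 0) (h1 : pderiv 1 (q 1) = 0)
    (h01 : pderiv 1 (q 0) + pderiv 0 (q 1) = 0) :
    IsRigidMotion fun x i => eval x (q i) := by
  have hcomm : ∀ p : MvPolynomial (Fin 2) ℝ,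
      pderiv 0 (pderiv 1 p) = pderiv 1 (pderiv 0 p) := by
    intro p
    ext m
    simp [coeff_pderiv, add_right_comm]
    ring
  have hq1 : pderiv 0 (q 1) = -pderiv 1 (q 0) := eq_neg_of_add_eq_zero_right h01
  have hconst : ∀ x, eval x (pderiv 1 (q 0)) = eval 0 (pderiv 1 (q 0)) := by
    intro x
    refine eval_eq_of_pderiv_eq_zero (fun i => ?_) x 0
    fin_cases i
    · simp [hcomm, h0]
    · have h := hcomm (q 1)
      rw [h1, hq1] at h
      simpa using h.symm
  set b := eval 0 (pderiv 1 (q 0)) with hb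
  have hC : pderiv 1 (q 0) = C b := MvPolynomial.funext fun x => by simpa using hconst x
  have e0 : ∀ x, eval x (q 0 - C b * X 1) = eval 0 (q 0 - C b * X 1) := by
    intro x
    refine eval_eq_of_pderiv_eq_zero (fun i => ?_) x 0
    fin_cases i <;> simp [h0, hC, pderiv_X]
  have e1 : ∀ x, eval x (q 1 + C b * X 0) = eval 0 (q 1 + C b * X 0) := by
    intro x
    refine eval_eq_of_pderiv_eq_zero (fun i => ?_) x 0
    fin_cases i <;> simp [h1, hq1, hC, pderiv_X]
  refine ⟨eval 0 (q 0), -b, eval 0 (q 1), fun x => ?_⟩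
  have a0 := e0 x
  have a1 := e1 x
  simp at a0 a1
  ext i
  fin_cases i
  · simp; linarith
  · simp; linarith

/-- A symmetric matrix form vanishing on two independent vectors and on their sum is zero. -/
theorem quadratic_form_eq_zero {a b c d e f g : ℝ} (hdet : a * d - b * c ≠ 0)
    (h1 : a ^ 2 * e + 2 * (a * b) * f + b ^ 2 * g = 0)
    (h2 : c ^ 2 * e + 2 * (c * d) * f + d ^ 2 * g = 0)
    (h3 : (a + c) ^ 2 * e + 2 * ((a + c) * (b + d)) * f + (b + d) ^ 2 * g = 0) :
    e = 0 ∧ f = 0 ∧ g = 0 := by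
  have h4 : a * c * e + (a * d + b * c) * f + b * d * g = 0 := by linarith
  have hdet2 : (a * d - b * c) ^ 2 ≠ 0 := pow_ne_zero 2 hdet
  refine ⟨?_, ?_, ?_⟩
  · refine (mul_eq_zero.1 (?_ : (a * d - b * c) ^ 2 * e = 0)).resolve_left hdet2
    linear_combination d ^ 2 * h1 - 2 * b * d * h4 + b ^ 2 * h2
  · refine (mul_eq_zero.1 (?_ : (a * d - b * c) ^ 2 * f = 0)).resolve_left hdet2
    linear_combination (-c * d) * h1 + (a * d + b * c) * h4 - a * b * h2
  · refine (mul_eq_zero.1 (?_ : (a * d - b * c) ^ 2 * g = 0)).resolve_left hdet2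
    linear_combination c ^ 2 * h1 - 2 * a * c * h4 + a ^ 2 * h2

theorem isCompact_Ktri (x0 x1 x2 : Fin 2 → ℝ) : IsCompact (Ktri x0 x1 x2) :=
  Set.Finite.isCompact_convexHull (𝕜 := ℝ) (by simp)

theorem interior_Ktri_nonempty {x0 x1 x2 : Fin 2 → ℝ}
    (hind : AffineIndependent ℝ ![x0, x1, x2]) : (interior (Ktri x0 x1 x2)).Nonempty := by
  have h := (hind.affineSpan_eq_top_iff_card_eq_finrank_add_one).2 (by simp)
  rw [Ktri, interior_convexHull_nonempty_iff_affineSpan_eq_top, ← h]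
  congr 1
  ext y
  simp only [Set.mem_insert_iff, Set.mem_singleton_iff, Set.mem_range, Fin.exists_fin_succ]
  simp [eq_comm]

theorem barycentric_nonneg {x0 x1 x2 : Fin 2 → ℝ} {lam : Fin 3 → (Fin 2 → ℝ) → ℝ}
    (hlam_aff : ∀ i, IsAffineFn (lam i))
    (hlam_val : ∀ i j : Fin 3, lam i (![x0, x1, x2] j) = if i = j then 1 else 0)
    (i : Fin 3) {x : Fin 2 → ℝ} (hx : x ∈ Ktri x0 x1 x2) : 0 ≤ lam i x := by
  obtain ⟨w, c, hw⟩ := hlam_aff i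
  have hconv : Convex ℝ {y : Fin 2 → ℝ | 0 ≤ lam i y} := by
    intro y hy z hz s t hs ht hst
    have h : lam i (s • y + t • z) = s * lam i y + t * lam i z := by
      simp only [hw, Pi.add_apply, Pi.smul_apply, smul_eq_mul]
      linear_combination (-c) * hst
    change 0 ≤ lam i (s • y + t • z)
    rw [h]
    exact add_nonneg (mul_nonneg hs hy) (mul_nonneg ht hz)
  refine convexHull_min ?_ hconv hx
  have hv : ∀ j, 0 ≤ lam i (![x0, x1, x2] j) := fun j => by
    rw [hlam_val]; split_ifs <;> norm_num
  rintro y (rfl | rfl | rfl)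
  exacts [hv 0, hv 1, hv 2]

theorem nvec_det_ne_zero {x0 x1 x2 : Fin 2 → ℝ} {lam : Fin 3 → (Fin 2 → ℝ) → ℝ}
    (hlam_aff : ∀ i, IsAffineFn (lam i))
    (hlam_val : ∀ i j : Fin 3, lam i (![x0, x1, x2] j) = if i = j then 1 else 0) :
    ((Bmat x0 x1 x2)⁻¹).det ≠ 0 := by
  obtain ⟨w, c, hw⟩ := hlam_aff 1
  obtain ⟨w', c', hw'⟩ := hlam_aff 2
  have hW : (Matrix.of ![w, w'] : Matrix (Fin 2) (Fin 2) ℝ) * Bmat x0 x1 x2 = 1 := by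
    have a0 := hlam_val 1 0
    have a1 := hlam_val 1 1
    have a2 := hlam_val 1 2
    have b0 := hlam_val 2 0
    have b1 := hlam_val 2 1
    have b2 := hlam_val 2 2
    simp [hw] at a0 a1 a2
    simp [hw'] at b0 b1 b2
    ext i j
    fin_cases i <;> fin_cases j <;> simp [Matrix.mul_apply, Bmat] <;> linarith
  have hdet := congrArg Matrix.det hW
  rw [Matrix.det_mul, Matrix.det_one] at hdet
  rw [Matrix.inv_eq_left_inv hW]
  exact left_ne_zero_of_mul_eq_one hdet

open MvPolynomial in
/-- The polynomial `tᵀ ε(v) t` for `v = (q 0, q 1)`. -/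
def strainPoly (q : Fin 2 → MvPolynomial (Fin 2) ℝ) (t : Fin 2 → ℝ) : MvPolynomial (Fin 2) ℝ :=
  ∑ i, ∑ j, C (t i * t j) * pderiv i (q j)

open MvPolynomial in
theorem totalDegree_strainPoly_le {q : Fin 2 → MvPolynomial (Fin 2) ℝ} {m : ℕ}
    (hq : ∀ i, (q i).totalDegree ≤ m + 1) (t : Fin 2 → ℝ) :
    (strainPoly q t).totalDegree ≤ m := by
  refine totalDegree_finsetSum_le fun i _ => totalDegree_finsetSum_le fun j _ => ?_
  refine (totalDegree_mul _ _).trans ?_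
  rw [totalDegree_C, zero_add]
  have := totalDegree_pderiv_le i (q j)
  have := hq j
  omega

open MvPolynomial in
theorem frob_vvT_symGrad (q : Fin 2 → MvPolynomial (Fin 2) ℝ) (t x : Fin 2 → ℝ) :
    frob (vvT t) (symGrad (fun x i => eval x (q i)) x) = eval x (strainPoly q t) := by
  simp only [frob, vvT, symGrad, strainPoly, pd_eval, Fin.sum_univ_two, Matrix.of_apply, map_add,
    map_mul, eval_C]
  ring

theorem frob_smul_left (a : ℝ) (A B : Matrix (Fin 2) (Fin 2) ℝ) :
    frob (a • A) B = a * frob A B := by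
  simp only [frob, Finset.mul_sum, mul_assoc, Matrix.smul_apply, smul_eq_mul]

theorem stmt_8 (k : ℕ) (hk : 2 ≤ k)
    (x0 x1 x2 : Fin 2 → ℝ)
    (hind : AffineIndependent ℝ ![x0, x1, x2])
    (lam : Fin 3 → (Fin 2 → ℝ) → ℝ)
    (hlam_aff : ∀ i, IsAffineFn (lam i))
    (hlam_val : ∀ i j : Fin 3, lam i (![x0, x1, x2] j) = if i = j then 1 else 0)
    (v : (Fin 2 → ℝ) → Fin 2 → ℝ)
    (hv : ∀ i, IsPolyDeg ((k : ℤ) - 1) (fun x => v x i))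
    (horth : ∀ τ, SigmaKb k x0 x1 x2 lam τ →
      ∫ x in Ktri x0 x1 x2, frob (τ x) (symGrad v x) = 0)
    (hrigid : ∀ r, IsRigidMotion r →
      ∫ x in Ktri x0 x1 x2, ∑ i : Fin 2, v x i * r x i = 0) :
    ∀ x, v x = 0 := by
  choose q hq hqd using hv
  have hdeg : ∀ i, (q i).totalDegree ≤ (k - 2) + 1 := fun i => by
    rcases hqd i with h | h
    · omega
    · simp [h]
  obtain rfl : v = fun x i => MvPolynomial.eval x (q i) := funext fun x => funext fun i => hq i x
  have hcpt := isCompact_Ktri x0 x1 x2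
  have hne := interior_Ktri_nonempty hind
  have hL : ∀ i, ∃ l : MvPolynomial (Fin 2) ℝ, ∀ x, MvPolynomial.eval x l = lam i x := fun i => by
    obtain ⟨w, c, hw⟩ := hlam_aff i
    exact ⟨.C (w 0) * .X 0 + .C (w 1) * .X 1 + .C c, fun x => by simp [hw]⟩
  choose L hL using hL
  have hL0 : ∀ i, L i ≠ 0 := fun i h => by
    have := hL i (![x0, x1, x2] i)
    rw [hlam_val, h] at this
    simp at this
  have hstrain : ∀ i, strainPoly q (perp (nvec x0 x1 x2 i)) = 0 := by
    intro i
    set S := strainPoly q (perp (nvec x0 x1 x2 i)) with hS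
    have hstress : ∀ x, frob (bubbleStress x0 x1 x2 lam
        (Pi.single i fun y => MvPolynomial.eval y S) x)
        (symGrad (fun x i => MvPolynomial.eval x (q i)) x)
        = MvPolynomial.eval x (L (i + 1) * L (i + 2) * S ^ 2) := by
      intro x
      rw [pow_two, ← mul_assoc, map_mul, hS, ← frob_vvT_symGrad q, ← hS]
      simp only [map_mul, hL]
      rw [← frob_smul_left]
      congr 1
      fin_cases i <;> simp [bubbleStress]
    have hzero := horth _ ⟨Pi.single i fun y => MvPolynomial.eval y S, fun j => ?_, rfl⟩
    · simp only [hstress] at hzero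
      have h := eq_zero_of_setIntegral_eq_zero hcpt hne (fun x hx => ?_) hzero
      · simpa [hL0] using h
      · simp only [map_mul, map_pow, hL]
        have := barycentric_nonneg hlam_aff hlam_val (i + 1) hx
        have := barycentric_nonneg hlam_aff hlam_val (i + 2) hx
        positivity
    · by_cases hj : j = i
      · subst hj
        refine ⟨S, fun x => by simp, Or.inl ?_⟩
        have := totalDegree_strainPoly_le hdeg (perp (nvec x0 x1 x2 j))
        rw [← hS] at this
        omega
      · exact ⟨0, fun x => by simp [hj], Or.inr rfl⟩
  have hdet := nvec_det_ne_zero hlam_aff hlam_val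
  rw [Matrix.det_fin_two] at hdet
  have hE : ∀ x, MvPolynomial.eval x (MvPolynomial.pderiv 0 (q 0)) = 0 ∧
      (MvPolynomial.eval x (MvPolynomial.pderiv 1 (q 0)) +
        MvPolynomial.eval x (MvPolynomial.pderiv 0 (q 1))) / 2 = 0 ∧
      MvPolynomial.eval x (MvPolynomial.pderiv 1 (q 1)) = 0 := by
    intro x
    have hs := fun i => congrArg (MvPolynomial.eval x) (hstrain i)
    have s0 := hs 0
    have s1 := hs 1
    have s2 := hs 2
    simp [strainPoly, perp, nvec] at s0 s1 s2
    set B := (Bmat x0 x1 x2)⁻¹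
    refine quadratic_form_eq_zero (a := -B 0 1) (b := B 0 0) (c := -B 1 1) (d := B 1 0)
      (fun h => hdet (by linarith)) ?_ ?_ ?_
    · linear_combination s1
    · linear_combination s2
    · linear_combination s0
  have hrig : IsRigidMotion fun x i => MvPolynomial.eval x (q i) :=
    isRigidMotion_of_symGrad_eq_zero
      (MvPolynomial.funext fun x => by simpa using (hE x).1)
      (MvPolynomial.funext fun x => by simpa using (hE x).2.2)
      (MvPolynomial.funext fun x => by simpa using (hE x).2.1)
  have hnorm := eq_zero_of_setIntegral_eq_zero hcpt hne (p := ∑ i, q i * q i)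
    (fun x _ => by simpa using add_nonneg (mul_self_nonneg _) (mul_self_nonneg _))
    (by simpa using hrigid _ hrig)
  intro x
  have hx := congrArg (MvPolynomial.eval x) hnorm
  simp only [map_sum, map_mul, map_zero] at hx
  rw [Finset.sum_eq_zero_iff_of_nonneg fun i _ => mul_self_nonneg _] at hx
  funext i
  simpa using hx i (Finset.mem_univ i)
end
end

section
/- Let k ≥ 3 be an integer and let v be a P_{k−1} vector field such that ∫_K v(x) · p(x) dx = 0 for every P_{k−2} vector field p. Then there exists τ ∈ Σ_{K,b} such that div τ = v identically on ℝ². -/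
open MeasureTheory

noncomputable section

open MvPolynomial in
theorem induction_of_totalDegree_le {P : MvPolynomial (Fin 2) ℝ → Prop} (m : ℕ) (zero : P 0)
    (add : ∀ p q, P p → P q → P (p + q))
    (monomial : ∀ i j : ℕ, i + j ≤ m → ∀ c : ℝ, P (C c * (X 0 ^ i * X 1 ^ j)))
    (q : MvPolynomial (Fin 2) ℝ) (hq : q.totalDegree ≤ m) : P q := by
  rw [q.as_sum]
  refine Finset.sum_induction _ P add zero fun s hs => ?_
  have hs' : s 0 + s 1 ≤ m := by
    have := (le_totalDegree hs).trans hq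
    rwa [Finsupp.sum_fintype _ _ (fun _ => rfl), Fin.sum_univ_two] at this
  have := monomial (s 0) (s 1) hs' (q.coeff s)
  rwa [← Fin.prod_univ_two (fun i => (X i : MvPolynomial (Fin 2) ℝ) ^ s i),
    ← Finsupp.prod_fintype s (fun i n => (X i : MvPolynomial (Fin 2) ℝ) ^ n) (by simp),
    ← monomial_eq] at this

/-- The reference triangle. -/
def refTri : Set (Fin 2 → ℝ) := {z | 0 ≤ z 0 ∧ 0 ≤ z 1 ∧ z 0 + z 1 ≤ 1}

theorem isClosed_refTri : IsClosed refTri := by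
  have h0 : Continuous fun z : Fin 2 → ℝ => z 0 := continuous_apply 0
  have h1 : Continuous fun z : Fin 2 → ℝ => z 1 := continuous_apply 1
  exact (isClosed_le continuous_const h0).inter
    ((isClosed_le continuous_const h1).inter (isClosed_le (h0.add h1) continuous_const))

theorem isCompact_refTri : IsCompact refTri := by
  refine (isCompact_Icc (a := (0 : Fin 2 → ℝ)) (b := 1)).of_isClosed_subset isClosed_refTri ?_
  rintro z ⟨h0, h1, h2⟩
  simp only [Set.mem_Icc, Pi.le_def, Fin.forall_fin_two, Pi.zero_apply, Pi.one_apply]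
  exact ⟨⟨h0, h1⟩, by linarith, by linarith⟩

theorem integrableOn_refTri {f : (Fin 2 → ℝ) → ℝ} (hf : Continuous f) :
    IntegrableOn f refTri :=
  hf.continuousOn.integrableOn_compact isCompact_refTri

/-- Integration of polynomials over the reference triangle. -/
def refInt : MvPolynomial (Fin 2) ℝ →ₗ[ℝ] ℝ where
  toFun q := ∫ z in refTri, MvPolynomial.eval z q
  map_add' p q := by
    simp only [map_add]
    exact integral_add (integrableOn_refTri (MvPolynomial.continuous_eval p))
      (integrableOn_refTri (MvPolynomial.continuous_eval q))
  map_smul' c q := by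
    simp only [MvPolynomial.smul_eval, RingHom.id_apply, smul_eq_mul]
    exact integral_const_mul c _

theorem eq_zero_of_refInt_mul_self {q : MvPolynomial (Fin 2) ℝ} (hq : refInt (q * q) = 0) :
    q = 0 := by
  have hc : Continuous fun z => MvPolynomial.eval z (q * q) := MvPolynomial.continuous_eval _
  have hae := (setIntegral_eq_zero_iff_of_nonneg_ae
    (Filter.Eventually.of_forall fun z => by simpa using mul_self_nonneg _)
    (integrableOn_refTri hc)).1 hq
  set U : Set (Fin 2 → ℝ) := Set.pi Set.univ fun _ => Set.Ioo (0 : ℝ) (1 / 2)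
  have hU : IsOpen U := isOpen_set_pi Set.finite_univ fun _ _ => isOpen_Ioo
  have hUT : U ⊆ refTri := by
    intro z hz
    have h0 := hz 0 trivial
    have h1 := hz 1 trivial
    exact ⟨h0.1.le, h1.1.le, by linarith [h0.2, h1.2]⟩
  have h := Measure.eqOn_open_of_ae_eq (ae_restrict_of_ae_restrict_of_subset hUT hae) hU
    hc.continuousOn continuousOn_const
  refine MvPolynomial.funext_set (fun _ => Set.Ioo (0 : ℝ) (1 / 2))
    (fun _ => Set.Ioo_infinite (by norm_num)) fun z hz => ?_
  simpa using h hz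

theorem hasFDerivAt_mvPolynomial_eval (q : MvPolynomial (Fin 2) ℝ) (z : Fin 2 → ℝ) :
    HasFDerivAt (fun y => MvPolynomial.eval y q)
      (∑ i, MvPolynomial.eval z (MvPolynomial.pderiv i q) •
        ContinuousLinearMap.proj (R := ℝ) (φ := fun _ : Fin 2 => ℝ) i) z := by
  induction q using MvPolynomial.induction_on with
  | C a => simpa using hasFDerivAt_const a z
  | add p q hp hq =>
    simp only [map_add]
    refine (hp.fun_add hq).congr_fderiv ?_
    simp only [add_smul, Finset.sum_add_distrib]
  | mul_X p j hp =>
    simp only [map_mul, MvPolynomial.eval_X]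
    refine (hp.fun_mul (hasFDerivAt_apply (𝕜 := ℝ) j z)).congr_fderiv ?_
    ext v
    fin_cases j <;> simp [Fin.sum_univ_two, MvPolynomial.pderiv_X] <;> ring

theorem refInt_pderiv_bubble (p : MvPolynomial (Fin 2) ℝ) :
    refInt (MvPolynomial.pderiv 1
      (MvPolynomial.X 1 * (1 - MvPolynomial.X 0 - MvPolynomial.X 1) * p)) = 0 := by
  set b := MvPolynomial.X 1 * (1 - MvPolynomial.X 0 - MvPolynomial.X 1) * p with hb
  set f : (Fin 2 → ℝ) → ℝ := fun z => MvPolynomial.eval z (MvPolynomial.pderiv 1 b) with hf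
  have hfc : Continuous f := MvPolynomial.continuous_eval _
  change ∫ z in refTri, f z = 0
  have hmeas := isClosed_refTri.measurableSet
  have e := volume_preserving_finTwoArrow ℝ
  rw [← integral_indicator hmeas,
    ← e.symm.integral_comp (MeasurableEquiv.measurableEmbedding _), Measure.volume_eq_prod,
    integral_prod]
  · refine integral_eq_zero_of_ae (Filter.Eventually.of_forall fun s => ?_)
    by_cases hs : 0 ≤ s ∧ s ≤ 1
    · have h1 : (fun t => refTri.indicator f (MeasurableEquiv.finTwoArrow.symm (s, t)))
          = (Set.Icc 0 (1 - s)).indicator fun t => f ![s, t] := by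
        funext t
        have : MeasurableEquiv.finTwoArrow.symm (s, t) = (![s, t] : Fin 2 → ℝ) := rfl
        rw [this]
        by_cases ht : t ∈ Set.Icc 0 (1 - s)
        · rw [Set.indicator_of_mem ht, Set.indicator_of_mem]
          exact ⟨hs.1, ht.1, by simpa using by linarith [ht.2]⟩
        · rw [Set.indicator_of_notMem ht, Set.indicator_of_notMem]
          rintro ⟨_, h2, h3⟩
          exact ht ⟨by simpa using h2, by simp at h3; linarith⟩
      have hd : ∀ t ∈ Set.uIcc 0 (1 - s),
          HasDerivAt (fun t => MvPolynomial.eval ![s, t] b) (f ![s, t]) t := by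
        intro t _
        have hline : HasDerivAt (fun t : ℝ => (![s, t] : Fin 2 → ℝ)) ![0, 1] t := by
          rw [hasDerivAt_pi]
          intro i
          fin_cases i
          · simpa using hasDerivAt_const t s
          · simpa using hasDerivAt_id' t
        refine ((hasFDerivAt_mvPolynomial_eval b ![s, t]).comp_hasDerivAt t hline).congr_deriv ?_
        simp [Fin.sum_univ_two, hf]
      have hcont : Continuous fun t : ℝ => f ![s, t] := by fun_prop
      change ∫ t, refTri.indicator f (MeasurableEquiv.finTwoArrow.symm (s, t)) = 0
      rw [h1, integral_indicator measurableSet_Icc, integral_Icc_eq_integral_Ioc,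
        ← intervalIntegral.integral_of_le (by linarith [hs.2]),
        intervalIntegral.integral_eq_sub_of_hasDerivAt hd (hcont.intervalIntegrable _ _)]
      simp [hb]
    · refine integral_eq_zero_of_ae (Filter.Eventually.of_forall fun t => ?_)
      refine Set.indicator_of_notMem ?_ _
      rintro ⟨h1, h2, h3⟩
      change 0 ≤ s at h1
      change 0 ≤ t at h2
      change s + t ≤ 1 at h3
      exact hs ⟨h1, by linarith⟩
  · exact e.symm.integrable_comp_of_integrable
      ((integrable_indicator_iff hmeas).2 (integrableOn_refTri hfc))

open MvPolynomial in
theorem exists_X_pow_mul_X_pow_eq (i j : ℕ) :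
    ∃ (p : MvPolynomial (Fin 2) ℝ) (r : Polynomial ℝ), (p.totalDegree + 1 ≤ i + j ∨ p = 0) ∧
      r.natDegree ≤ i + j ∧
      X 0 ^ j * X 1 ^ i = pderiv 1 (X 1 * (1 - X 0 - X 1) * p) + Polynomial.aeval (X 0) r := by
  induction i with
  | zero => exact ⟨0, Polynomial.X ^ j, by simp, by simp, by simp⟩
  | succ i ih =>
    obtain ⟨p, r, hp, hr, h⟩ := ih
    set c : ℝ := ((i : ℝ) + 2)⁻¹
    have hc : (C c : MvPolynomial (Fin 2) ℝ) * (i + 2) = 1 := by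
      have : (C c : MvPolynomial (Fin 2) ℝ) * C ((i : ℝ) + 2) = 1 := by
        rw [← C_mul, inv_mul_cancel₀ (by positivity), C_1]
      rwa [C_add, map_natCast, map_ofNat] at this
    have hX (n : Fin 2) : (X n : MvPolynomial (Fin 2) ℝ).totalDegree = 1 := totalDegree_X n
    have h1 : (1 - X 0 : MvPolynomial (Fin 2) ℝ).totalDegree ≤ 1 :=
      (totalDegree_sub _ _).trans (by simp)
    refine ⟨C c * ((1 - X 0) * (C ((i : ℝ) + 1) * p) - X 0 ^ j * X 1 ^ i),
      Polynomial.C (c * (i + 1)) * ((1 - Polynomial.X) * r), Or.inl ?_, ?_, ?_⟩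
    · have h2 : ((1 - X 0) * (C ((i : ℝ) + 1) * p)).totalDegree ≤ i + j := by
        rcases hp with hp | rfl
        · refine (totalDegree_mul _ _).trans ?_
          have := totalDegree_mul (C ((i : ℝ) + 1)) p
          rw [totalDegree_C] at this
          omega
        · simp
      have h3 : (X 0 ^ j * X 1 ^ i : MvPolynomial (Fin 2) ℝ).totalDegree ≤ i + j := by
        refine (totalDegree_mul _ _).trans ?_
        simp [add_comm]
      have h4 := (totalDegree_sub _ _).trans (max_le h2 h3)
      have h5 := totalDegree_mul (C c) ((1 - X 0) * (C ((i : ℝ) + 1) * p) - X 0 ^ j * X 1 ^ i)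
      rw [totalDegree_C] at h5
      omega
    · refine (Polynomial.natDegree_C_mul_le _ _).trans (Polynomial.natDegree_mul_le.trans ?_)
      have : (1 - Polynomial.X : Polynomial ℝ).natDegree ≤ 1 :=
        (Polynomial.natDegree_sub_le _ _).trans (by simp)
      omega
    · have hpow : pderiv 1 (X 1 ^ (i + 1) : MvPolynomial (Fin 2) ℝ) =
          ((i : MvPolynomial (Fin 2) ℝ) + 1) * X 1 ^ i := by
        simp
      have hpow0 : pderiv 1 (X 0 ^ j : MvPolynomial (Fin 2) ℝ) = 0 := by
        simp
      have hb : pderiv 1 (X 1 ^ (i + 1) * ((1 - X 0 - X 1) * X 0 ^ j) : MvPolynomial (Fin 2) ℝ)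
          = ((i : MvPolynomial (Fin 2) ℝ) + 1) * (1 - X 0) * (X 0 ^ j * X 1 ^ i)
            - ((i : MvPolynomial (Fin 2) ℝ) + 2) * (X 0 ^ j * X 1 ^ (i + 1)) := by
        rw [pderiv_mul, pderiv_mul, hpow, hpow0]
        simp
        ring
      have hsplit : (X 1 * (1 - X 0 - X 1) *
            (C c * ((1 - X 0) * (C ((i : ℝ) + 1) * p) - X 0 ^ j * X 1 ^ i)) :
              MvPolynomial (Fin 2) ℝ)
          = C c * ((((i : MvPolynomial (Fin 2) ℝ) + 1) * (1 - X 0)) * (X 1 * (1 - X 0 - X 1) * p)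
              - X 1 ^ (i + 1) * ((1 - X 0 - X 1) * X 0 ^ j)) := by
        simp
        ring
      have hconst : pderiv 1 (((i : MvPolynomial (Fin 2) ℝ) + 1) * (1 - X 0)) = 0 := by
        simp
      rw [hsplit, pderiv_C_mul, map_sub, hb, pderiv_mul, hconst]
      simp only [map_mul, map_sub, Polynomial.aeval_C, Polynomial.aeval_X, map_one,
        MvPolynomial.algebraMap_eq, map_add, map_natCast]
      simp only [zero_mul, zero_add]
      linear_combination (-X 0 ^ j * X 1 ^ (i + 1)) * hc + C c * (i + 1) * (1 - X 0) * h

open MvPolynomial in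
theorem exists_eq_pderiv_bubble_add (m : ℕ) (q : MvPolynomial (Fin 2) ℝ)
    (hq : q.totalDegree ≤ m) :
    ∃ (p : MvPolynomial (Fin 2) ℝ) (r : Polynomial ℝ), p.totalDegree ≤ m - 1 ∧
      r.natDegree ≤ m ∧
      q = pderiv 1 (X 1 * (1 - X 0 - X 1) * p) + Polynomial.aeval (X 0) r := by
  refine induction_of_totalDegree_le (P := fun q => ∃ (p : MvPolynomial (Fin 2) ℝ)
    (r : Polynomial ℝ), p.totalDegree ≤ m - 1 ∧ r.natDegree ≤ m ∧
      q = pderiv 1 (X 1 * (1 - X 0 - X 1) * p) + Polynomial.aeval (X 0) r)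
    m ⟨0, 0, by simp⟩ ?_ ?_ q hq
  · rintro _ _ ⟨p, r, hp1, hp2, rfl⟩ ⟨p', r', hq1, hq2, rfl⟩
    refine ⟨p + p', r + r', (totalDegree_add _ _).trans (max_le hp1 hq1),
      (Polynomial.natDegree_add_le _ _).trans (max_le hp2 hq2), ?_⟩
    rw [mul_add, map_add, map_add]
    ring
  · intro j i hij c
    obtain ⟨p, r, hp, hr, h⟩ := exists_X_pow_mul_X_pow_eq i j
    refine ⟨C c * p, Polynomial.C c * r, ?_, (Polynomial.natDegree_C_mul_le _ _).trans
      (hr.trans (by omega)), ?_⟩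
    · rcases hp with hp | rfl
      · have := totalDegree_mul (C c) p
        rw [totalDegree_C] at this
        omega
      · simp
    · rw [h, mul_left_comm, pderiv_C_mul, map_mul (Polynomial.aeval _), Polynomial.aeval_C,
        algebraMap_eq]
      ring

open MvPolynomial in
theorem exists_eq_pderiv_bubble (m : ℕ) (q : MvPolynomial (Fin 2) ℝ)
    (hq : q.totalDegree ≤ m) (horth : ∀ j ≤ m, refInt (q * X 0 ^ j) = 0) :
    ∃ p : MvPolynomial (Fin 2) ℝ, p.totalDegree ≤ m - 1 ∧
      q = pderiv 1 (X 1 * (1 - X 0 - X 1) * p) := by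
  obtain ⟨p, r, hp, hr, h⟩ := exists_eq_pderiv_bubble_add m q hq
  refine ⟨p, hp, ?_⟩
  have hr0 : ∀ j ≤ m, refInt (Polynomial.aeval (X 0) r * X 0 ^ j) = 0 := by
    intro j hj
    have h0 : pderiv 1 (X 0 ^ j : MvPolynomial (Fin 2) ℝ) = 0 := by
      simp
    have h1 : pderiv 1 (X 1 * (1 - X 0 - X 1) * p) * X 0 ^ j
        = pderiv 1 (X 1 * (1 - X 0 - X 1) * (p * X 0 ^ j)) := by
      rw [← mul_assoc, pderiv_mul (f := X 1 * (1 - X 0 - X 1) * p), h0]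
      ring
    have h2 := horth j hj
    rwa [h, add_mul, map_add, h1, refInt_pderiv_bubble, zero_add] at h2
  have hrr : refInt (Polynomial.aeval (X 0) r * Polynomial.aeval (X 0) r) = 0 := by
    nth_rw 2 [r.as_sum_range' (m + 1) (by omega)]
    rw [map_sum, Finset.mul_sum, map_sum]
    refine Finset.sum_eq_zero fun j hj => ?_
    rw [Polynomial.aeval_monomial, algebraMap_eq, mul_left_comm, C_mul', map_smul,
      hr0 j (by simpa [Nat.lt_succ_iff] using hj), smul_zero]
  rw [h, eq_zero_of_refInt_mul_self hrr, add_zero]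

theorem exists_refInt_mul_eq (m : ℕ)
    (φ : MvPolynomial (Fin 2) ℝ →ₗ[ℝ] ℝ) :
    ∃ g : MvPolynomial (Fin 2) ℝ, g.totalDegree ≤ m ∧
      ∀ q : MvPolynomial (Fin 2) ℝ, q.totalDegree ≤ m → refInt (g * q) = φ q := by
  set V := MvPolynomial.restrictTotalDegree (Fin 2) ℝ m
  set B : V →ₗ[ℝ] Module.Dual ℝ V :=
    (((LinearMap.mul ℝ (MvPolynomial (Fin 2) ℝ)).compr₂ refInt).domRestrict₁₂ V V)
  have hB : Function.Injective B := by
    rw [injective_iff_map_eq_zero]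
    intro g hg
    have h : refInt ((g : MvPolynomial (Fin 2) ℝ) * g) = 0 :=
      LinearMap.congr_fun hg g
    exact Subtype.ext (eq_zero_of_refInt_mul_self h)
  obtain ⟨g, hg⟩ := (LinearMap.injective_iff_surjective_of_finrank_eq_finrank
    (Subspace.dual_finrank_eq (K := ℝ) (V := V)).symm).1 hB (φ.domRestrict V)
  refine ⟨g, (MvPolynomial.mem_restrictTotalDegree _ _ _).1 g.2, fun q hq => ?_⟩
  exact LinearMap.congr_fun hg
    ⟨q, (MvPolynomial.mem_restrictTotalDegree _ _ _).2 hq⟩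

/-- The degree `m` part of a polynomial of degree at most `m`, evaluated at `(s, t)`. -/
def topEval (m : ℕ) (s t : ℝ) : MvPolynomial (Fin 2) ℝ →ₗ[ℝ] ℝ :=
  Polynomial.lcoeff ℝ m ∘ₗ
    (MvPolynomial.aeval ![Polynomial.C s * Polynomial.X,
      Polynomial.C t * Polynomial.X]).toLinearMap

theorem coeff_linear_pow (m j : ℕ) (hj : j ≤ m) (a b : ℝ) :
    ((Polynomial.C a * Polynomial.X + Polynomial.C b) ^ j).coeff m =
      if j = m then a ^ m else 0 := by
  have hd : (Polynomial.C a * Polynomial.X + Polynomial.C b).natDegree ≤ 1 :=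
    Polynomial.natDegree_linear_le
  split_ifs with h
  · subst h
    simpa using Polynomial.coeff_pow_of_natDegree_le (m := j) hd
  · refine Polynomial.coeff_eq_zero_of_natDegree_lt ?_
    have := Polynomial.natDegree_pow_le_of_le j hd
    omega

open MvPolynomial in
theorem topEval_linear_pow (m j : ℕ) (hj : j ≤ m) (s t a b c : ℝ) :
    topEval m s t ((C a * X 0 + C b * X 1 + C c) ^ j) =
      if j = m then (a * s + b * t) ^ m else 0 := by
  rw [← coeff_linear_pow m j hj (a * s + b * t) c]
  simp [topEval, Polynomial.lcoeff_apply]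
  congr 2
  ring

open MvPolynomial in
theorem exists_refInt_mul_pow_eq (m : ℕ) (hm : 2 ≤ m) (α β : ℝ) :
    ∃ g : MvPolynomial (Fin 2) ℝ, g.totalDegree ≤ m ∧
      (∀ j ≤ m, refInt (g * X 0 ^ j) = if j = m then α else 0) ∧
      (∀ j ≤ m, refInt (g * X 1 ^ j) = if j = m then β else 0) ∧
      ∀ j ≤ m, refInt (g * (1 - X 0 - X 1) ^ j) = 0 := by
  have h2 : (2 : ℝ) ^ m - 2 ≠ 0 := by
    have : (2 : ℝ) ^ 1 < 2 ^ m := pow_lt_pow_right₀ (by norm_num) (by omega)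
    linarith
  have hm0 : m ≠ 0 := by omega
  set c : ℝ := -(α + β) / (2 ^ m - 2)
  have hc : α + β + c * (2 ^ m - 2) = 0 := by
    simp only [c]; field_simp; ring
  obtain ⟨g, hg, h⟩ := exists_refInt_mul_eq m
    ((α - c) • topEval m 1 0 + (β - c) • topEval m 0 1 + c • topEval m 1 1)
  have key (j : ℕ) (hj : j ≤ m) (a b d : ℝ) :
      refInt (g * (C a * X 0 + C b * X 1 + C d) ^ j) =
        if j = m then (α - c) * a ^ m + (β - c) * b ^ m + c * (a + b) ^ m else 0 := by
    rw [h]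
    · simp only [LinearMap.add_apply, LinearMap.smul_apply, topEval_linear_pow m j hj]
      split_ifs <;> simp
    · have h1 : (C a * X 0 : MvPolynomial (Fin 2) ℝ).totalDegree ≤ 1 := by
        simpa using totalDegree_mul (C a) (X 0 : MvPolynomial (Fin 2) ℝ)
      have h2 : (C b * X 1 : MvPolynomial (Fin 2) ℝ).totalDegree ≤ 1 := by
        simpa using totalDegree_mul (C b) (X 1 : MvPolynomial (Fin 2) ℝ)
      have h3 : (C a * X 0 + C b * X 1 + C d : MvPolynomial (Fin 2) ℝ).totalDegree ≤ 1 :=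
        (totalDegree_add _ _).trans (max_le ((totalDegree_add _ _).trans (max_le h1 h2))
          (by simp))
      refine (totalDegree_pow _ _).trans ?_
      calc _ ≤ j * 1 := Nat.mul_le_mul_left j h3
        _ ≤ m := by omega
  refine ⟨g, hg, fun j hj => ?_, fun j hj => ?_, fun j hj => ?_⟩
  · simpa [hm0] using key j hj 1 0 0
  · simpa [hm0] using key j hj 0 1 0
  · have h3 := key j hj (-1) (-1) 1
    have h4 : (C (-1) * X 0 + C (-1) * X 1 + C 1 : MvPolynomial (Fin 2) ℝ)
        = 1 - X 0 - X 1 := by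
      simp only [C_neg, C_1]; ring
    have h5 : (-1 + -1 : ℝ) ^ m = (-1) ^ m * 2 ^ m := by
      rw [← mul_pow]; norm_num
    rw [h4, h5] at h3
    rw [h3, ite_eq_right_iff]
    intro _
    linear_combination (-1) ^ m * hc

theorem isPolyDeg_natCast_iff {n : ℕ} {f : (Fin 2 → ℝ) → ℝ} :
    IsPolyDeg n f ↔
      ∃ q : MvPolynomial (Fin 2) ℝ, q.totalDegree ≤ n ∧ ∀ x, f x = MvPolynomial.eval x q := by
  constructor
  · rintro ⟨q, hq, h | rfl⟩
    · exact ⟨q, by exact_mod_cast h, hq⟩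
    · exact ⟨0, by simp, hq⟩
  · rintro ⟨q, h, hq⟩
    exact ⟨q, hq, Or.inl (by exact_mod_cast h)⟩

theorem IsPolyDeg.continuous {m : ℤ} {f : (Fin 2 → ℝ) → ℝ} (hf : IsPolyDeg m f) :
    Continuous f := by
  obtain ⟨q, hq, -⟩ := hf
  rw [funext hq]
  exact MvPolynomial.continuous_eval q

theorem IsPolyDeg.add {n : ℕ} {f g : (Fin 2 → ℝ) → ℝ} (hf : IsPolyDeg n f)
    (hg : IsPolyDeg n g) : IsPolyDeg n fun x => f x + g x := by
  rw [isPolyDeg_natCast_iff] at *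
  obtain ⟨p, hp, hfp⟩ := hf
  obtain ⟨q, hq, hgq⟩ := hg
  exact ⟨p + q, (MvPolynomial.totalDegree_add _ _).trans (max_le hp hq),
    fun x => by rw [hfp, hgq, map_add]⟩

theorem IsPolyDeg.const_mul {n : ℕ} {f : (Fin 2 → ℝ) → ℝ} (c : ℝ) (hf : IsPolyDeg n f) :
    IsPolyDeg n fun x => c * f x := by
  rw [isPolyDeg_natCast_iff] at *
  obtain ⟨p, hp, hfp⟩ := hf
  refine ⟨MvPolynomial.C c * p, (MvPolynomial.totalDegree_mul _ _).trans (by simpa using hp),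
    fun x => by simp [hfp]⟩

open MvPolynomial in
theorem IsAffineFn.exists_eval {f : (Fin 2 → ℝ) → ℝ} (hf : IsAffineFn f) :
    ∃ q : MvPolynomial (Fin 2) ℝ, q.totalDegree ≤ 1 ∧ ∀ x, f x = eval x q := by
  obtain ⟨w, c, h⟩ := hf
  have hX (i : Fin 2) : (C (w i) * X i : MvPolynomial (Fin 2) ℝ).totalDegree ≤ 1 := by
    simpa using totalDegree_mul (C (w i)) (X i : MvPolynomial (Fin 2) ℝ)
  exact ⟨C (w 0) * X 0 + C (w 1) * X 1 + C c, (totalDegree_add _ _).trans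
    (max_le ((totalDegree_add _ _).trans (max_le (hX 0) (hX 1))) (by simp)),
    fun x => by simp [h]⟩

theorem IsAffineFn.pow_isPolyDeg {f : (Fin 2 → ℝ) → ℝ} (hf : IsAffineFn f) {j n : ℕ}
    (hj : j ≤ n) : IsPolyDeg n fun x => f x ^ j := by
  obtain ⟨q, hq, h⟩ := hf.exists_eval
  refine isPolyDeg_natCast_iff.2 ⟨q ^ j, (MvPolynomial.totalDegree_pow _ _).trans ?_,
    fun x => by simp [h]⟩
  calc _ ≤ j * 1 := Nat.mul_le_mul_left j hq
    _ ≤ n := by omega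

open MvPolynomial in
theorem IsPolyDeg.comp_affine {m : ℕ} {f : (Fin 2 → ℝ) → ℝ} (hf : IsPolyDeg m f)
    {F : (Fin 2 → ℝ) → Fin 2 → ℝ} (hF : ∀ i, IsAffineFn fun x => F x i) :
    IsPolyDeg m fun x => f (F x) := by
  rw [isPolyDeg_natCast_iff] at *
  obtain ⟨q, hq, hfq⟩ := hf
  simp only [hfq]
  choose P hP hFP using fun i => (hF i).exists_eval
  refine induction_of_totalDegree_le (P := fun q => ∃ q' : MvPolynomial (Fin 2) ℝ,
    q'.totalDegree ≤ m ∧ ∀ x, eval (F x) q = eval x q') m ⟨0, by simp⟩ ?_ ?_ q hq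
  · rintro p q ⟨p', hp, hp'⟩ ⟨q', hq, hq'⟩
    exact ⟨p' + q', (totalDegree_add _ _).trans (max_le hp hq), fun x => by simp [hp', hq']⟩
  · intro i j hij c
    refine ⟨C c * (P 0 ^ i * P 1 ^ j), ?_, fun x => by simp [hFP]⟩
    have h0 := totalDegree_mul (C c) (P 0 ^ i * P 1 ^ j)
    have h1 := totalDegree_mul (P 0 ^ i) (P 1 ^ j)
    have h2 := (totalDegree_pow (P 0) i).trans (Nat.mul_le_mul_left i (hP 0))
    have h3 := (totalDegree_pow (P 1) j).trans (Nat.mul_le_mul_left j (hP 1))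
    rw [totalDegree_C] at h0
    omega

/-- `u` and `w` are the barycentric coordinates at `y1` and `y2` of the triangle with vertices
`y0`, `y1`, `y2`. -/
structure IsChart (y0 y1 y2 : Fin 2 → ℝ) (u w : (Fin 2 → ℝ) → ℝ) : Prop where
  affine_fst : IsAffineFn u
  affine_snd : IsAffineFn w
  fst_zero : u y0 = 0
  fst_one : u y1 = 1
  fst_two : u y2 = 0
  snd_zero : w y0 = 0
  snd_one : w y1 = 0
  snd_two : w y2 = 1

/-- The affine map from the reference triangle to the triangle with vertices `y0`, `y1`, `y2`. -/
def triParam (y0 y1 y2 : Fin 2 → ℝ) (z : Fin 2 → ℝ) : Fin 2 → ℝ :=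
  fun i => y0 i + (y1 i - y0 i) * z 0 + (y2 i - y0 i) * z 1

theorem IsAffineFn.apply_triParam {f : (Fin 2 → ℝ) → ℝ} (hf : IsAffineFn f)
    (y0 y1 y2 z : Fin 2 → ℝ) :
    f (triParam y0 y1 y2 z) = (1 - z 0 - z 1) * f y0 + z 0 * f y1 + z 1 * f y2 := by
  obtain ⟨w, c, h⟩ := hf
  simp only [h, triParam]
  ring

theorem isAffineFn_triParam (y0 y1 y2 : Fin 2 → ℝ) (i : Fin 2) :
    IsAffineFn fun z => triParam y0 y1 y2 z i :=
  ⟨![y1 i - y0 i, y2 i - y0 i], y0 i, fun z => by simp [triParam]; ring⟩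

theorem hasFDerivAt_triParam (y0 y1 y2 z : Fin 2 → ℝ) :
    HasFDerivAt (triParam y0 y1 y2) (Matrix.mulVecLin (Bmat y0 y1 y2)).toContinuousLinearMap z := by
  have h : triParam y0 y1 y2 =
      fun z => y0 + (Matrix.mulVecLin (Bmat y0 y1 y2)).toContinuousLinearMap z := by
    funext z i
    fin_cases i <;> simp [triParam, Bmat] <;> ring
  rw [h]
  exact (ContinuousLinearMap.hasFDerivAt _).const_add y0

open scoped Matrix

namespace IsChart

variable {y0 y1 y2 : Fin 2 → ℝ} {u w : (Fin 2 → ℝ) → ℝ}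

theorem isAffineFn (h : IsChart y0 y1 y2 u w) (i : Fin 2) :
    IsAffineFn fun x => (![u x, w x] : Fin 2 → ℝ) i := by
  fin_cases i
  · exact h.affine_fst
  · exact h.affine_snd

theorem right_inv (h : IsChart y0 y1 y2 u w) (z : Fin 2 → ℝ) :
    ![u (triParam y0 y1 y2 z), w (triParam y0 y1 y2 z)] = z := by
  rw [h.affine_fst.apply_triParam, h.affine_snd.apply_triParam, h.fst_zero, h.fst_one, h.fst_two,
    h.snd_zero, h.snd_one, h.snd_two]
  ext i
  fin_cases i <;> simp

theorem left_inv_and_det (h : IsChart y0 y1 y2 u w) :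
    (∀ x, triParam y0 y1 y2 ![u x, w x] = x) ∧ (Bmat y0 y1 y2).det ≠ 0 := by
  obtain ⟨a, c, ha⟩ := h.affine_fst
  obtain ⟨b, d, hb⟩ := h.affine_snd
  have h1 := h.fst_zero
  have h2 := h.fst_one
  have h3 := h.fst_two
  have h4 := h.snd_zero
  have h5 := h.snd_one
  have h6 := h.snd_two
  rw [ha] at h1 h2 h3
  rw [hb] at h4 h5 h6
  have hW : Matrix.of ![a, b] * Bmat y0 y1 y2 = 1 := by
    ext i j
    fin_cases i <;> fin_cases j <;> simp [Matrix.mul_apply, Bmat, Fin.sum_univ_two] <;> linarith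
  have hB := mul_eq_one_comm.1 hW
  refine ⟨fun x => ?_, fun h0 => ?_⟩
  · have hx : Bmat y0 y1 y2 *ᵥ (Matrix.of ![a, b] *ᵥ (x - y0)) = x - y0 := by
      rw [Matrix.mulVec_mulVec, hB, Matrix.one_mulVec]
    have hz : Matrix.of ![a, b] *ᵥ (x - y0) = ![u x, w x] := by
      ext i
      fin_cases i <;> simp [Matrix.mulVec, dotProduct, Fin.sum_univ_two, ha, hb] <;> linarith
    rw [hz] at hx
    ext i
    have := congrFun hx i
    simp [Bmat, Matrix.mulVec, dotProduct, Fin.sum_univ_two] at this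
    simp [triParam]
    linarith
  · have := congrArg Matrix.det hW
    rw [Matrix.det_mul, h0, mul_zero, Matrix.det_one] at this
    exact zero_ne_one this

theorem left_inv (h : IsChart y0 y1 y2 u w) (x : Fin 2 → ℝ) :
    triParam y0 y1 y2 ![u x, w x] = x :=
  h.left_inv_and_det.1 x

theorem det_ne_zero (h : IsChart y0 y1 y2 u w) : (Bmat y0 y1 y2).det ≠ 0 :=
  h.left_inv_and_det.2

theorem image_refTri (h : IsChart y0 y1 y2 u w) :
    triParam y0 y1 y2 '' refTri = Ktri y0 y1 y2 := by
  have hmem (x : Fin 2 → ℝ) : x ∈ triParam y0 y1 y2 '' refTri ↔ ![u x, w x] ∈ refTri := by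
    constructor
    · rintro ⟨z, hz, rfl⟩
      rwa [h.right_inv]
    · intro hx
      exact ⟨_, hx, h.left_inv x⟩
  apply Set.Subset.antisymm
  · rintro _ ⟨z, ⟨h0, h1, h2⟩, rfl⟩
    have hc : Convex ℝ (Ktri y0 y1 y2) := convex_convexHull ℝ _
    have hy : ∀ i ∈ (Finset.univ : Finset (Fin 3)), ![y0, y1, y2] i ∈ Ktri y0 y1 y2 := by
      intro i _
      refine subset_convexHull ℝ _ ?_
      fin_cases i <;> simp
    have := hc.sum_mem (t := Finset.univ) (w := ![1 - z 0 - z 1, z 0, z 1])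
      (by intro i _; fin_cases i <;> simp <;> linarith)
      (by simp [Fin.sum_univ_three]; ring) hy
    convert this using 1
    ext i
    simp [Fin.sum_univ_three, triParam]
    ring
  · refine convexHull_min ?_ ?_
    · rintro x (rfl | rfl | rfl) <;> rw [hmem] <;>
        simp [refTri, h.fst_zero, h.fst_one, h.fst_two, h.snd_zero, h.snd_one, h.snd_two]
    · intro x hx y hy a b ha hb hab
      rw [hmem] at hx hy ⊢
      obtain ⟨p, c, hp⟩ := h.affine_fst
      obtain ⟨q, d, hq⟩ := h.affine_snd
      have hu : u (a • x + b • y) = a * u x + b * u y := by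
        simp only [hp, Pi.add_apply, Pi.smul_apply, smul_eq_mul]
        linear_combination -c * hab
      have hw : w (a • x + b • y) = a * w x + b * w y := by
        simp only [hq, Pi.add_apply, Pi.smul_apply, smul_eq_mul]
        linear_combination -d * hab
      obtain ⟨hx0, hx1, hx2⟩ := hx
      obtain ⟨hy0, hy1, hy2⟩ := hy
      simp only [Matrix.cons_val_zero, Matrix.cons_val_one] at hx0 hx1 hx2 hy0 hy1 hy2
      simp only [refTri, hu, hw, Set.mem_ofPred_eq, Matrix.cons_val_zero, Matrix.cons_val_one]
      refine ⟨by positivity, by positivity, ?_⟩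
      nlinarith [mul_le_mul_of_nonneg_left hx2 ha, mul_le_mul_of_nonneg_left hy2 hb]

theorem setIntegral_eq (h : IsChart y0 y1 y2 u w) (f : (Fin 2 → ℝ) → ℝ) :
    ∫ x in Ktri y0 y1 y2, f ![u x, w x] = |(Bmat y0 y1 y2).det| * ∫ z in refTri, f z := by
  have hinj : Function.Injective (triParam y0 y1 y2) := fun z z' hz => by
    rw [← h.right_inv z, ← h.right_inv z', hz]
  rw [← h.image_refTri, integral_image_eq_integral_abs_det_fderiv_smul volume
    isClosed_refTri.measurableSet
    (fun z _ => (hasFDerivAt_triParam y0 y1 y2 z).hasFDerivWithinAt) hinj.injOn]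
  simp only [h.right_inv, smul_eq_mul, integral_const_mul]
  congr 2
  rw [ContinuousLinearMap.det, LinearMap.coe_toContinuousLinearMap, ← Matrix.toLin'_apply',
    LinearMap.det_toLin']

theorem setIntegral_eval (h : IsChart y0 y1 y2 u w) (q : MvPolynomial (Fin 2) ℝ) :
    ∫ x in Ktri y0 y1 y2, MvPolynomial.eval ![u x, w x] q =
      |(Bmat y0 y1 y2).det| * refInt q :=
  h.setIntegral_eq fun z => MvPolynomial.eval z q

theorem exists_eval (h : IsChart y0 y1 y2 u w) {m : ℕ} {f : (Fin 2 → ℝ) → ℝ}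
    (hf : IsPolyDeg m f) :
    ∃ q : MvPolynomial (Fin 2) ℝ, q.totalDegree ≤ m ∧
      ∀ x, f x = MvPolynomial.eval ![u x, w x] q := by
  obtain ⟨q, hq, hfq⟩ :=
    isPolyDeg_natCast_iff.1 (hf.comp_affine (isAffineFn_triParam y0 y1 y2))
  exact ⟨q, hq, fun x => by rw [← hfq, h.left_inv]⟩

theorem isPolyDeg_eval (h : IsChart y0 y1 y2 u w) {m : ℕ} {q : MvPolynomial (Fin 2) ℝ}
    (hq : q.totalDegree ≤ m) : IsPolyDeg m fun x => MvPolynomial.eval ![u x, w x] q :=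
  (isPolyDeg_natCast_iff.2 ⟨q, hq, fun _ => rfl⟩ :
    IsPolyDeg m fun x => MvPolynomial.eval x q).comp_affine h.isAffineFn

theorem hasFDerivAt_eval (h : IsChart y0 y1 y2 u w) (q : MvPolynomial (Fin 2) ℝ)
    (x : Fin 2 → ℝ) :
    ∃ f' : (Fin 2 → ℝ) →L[ℝ] ℝ,
      HasFDerivAt (fun y => MvPolynomial.eval ![u y, w y] q) f' x ∧
      ∀ c : ℝ, f' (fun i => c * (y2 i - y0 i)) =
        c * MvPolynomial.eval ![u x, w x] (MvPolynomial.pderiv 1 q) := by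
  obtain ⟨a, d, ha⟩ := h.affine_fst
  obtain ⟨b, e, hb⟩ := h.affine_snd
  set L : (Fin 2 → ℝ) →L[ℝ] (Fin 2 → ℝ) :=
    (Matrix.mulVecLin (Matrix.of ![a, b])).toContinuousLinearMap
  have hA : (fun y => ![u y, w y]) = fun y => L y + ![d, e] := by
    funext y i
    fin_cases i <;> simp [L, ha, hb, dotProduct, Fin.sum_univ_two]
  have hA' : HasFDerivAt (fun y => ![u y, w y]) L x := by
    rw [hA]
    exact L.hasFDerivAt.add_const _
  refine ⟨_, HasFDerivAt.comp (g := fun z => MvPolynomial.eval z q) x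
    (hasFDerivAt_mvPolynomial_eval q ![u x, w x]) hA', fun c => ?_⟩
  have h1 := h.fst_zero
  have h2 := h.fst_two
  have h3 := h.snd_zero
  have h4 := h.snd_two
  rw [ha] at h1 h2
  rw [hb] at h3 h4
  have hL : L (fun i => c * (y2 i - y0 i)) = ![0, c] := by
    ext i
    fin_cases i <;> simp [L, Matrix.mulVec, dotProduct, Fin.sum_univ_two]
    · linear_combination c * h2 - c * h1
    · linear_combination c * h4 - c * h3
  simp [hL, Fin.sum_univ_two, mul_comm]

open MvPolynomial in
theorem exists_bubble (h : IsChart y0 y1 y2 u w) {m : ℕ} {f : (Fin 2 → ℝ) → ℝ}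
    (hf : IsPolyDeg m f) (horth : ∀ j ≤ m, ∫ x in Ktri y0 y1 y2, f x * u x ^ j = 0)
    {c : ℝ} (hc : c ≠ 0) :
    ∃ p : (Fin 2 → ℝ) → ℝ, IsPolyDeg (m - 1 : ℕ) p ∧ ∀ x, ∃ f' : (Fin 2 → ℝ) →L[ℝ] ℝ,
      HasFDerivAt (fun y => w y * (1 - u y - w y) * p y) f' x ∧
      f' (fun i => c * (y2 i - y0 i)) = f x := by
  obtain ⟨q, hq, hfq⟩ := h.exists_eval hf
  obtain ⟨p, hp, hpq⟩ := exists_eq_pderiv_bubble m q hq fun j hj => by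
    have h1 := h.setIntegral_eval (q * X 0 ^ j)
    simp only [map_mul, map_pow, eval_X, Matrix.cons_val_zero, ← hfq] at h1
    rw [horth j hj] at h1
    exact (mul_eq_zero.1 h1.symm).resolve_left (abs_ne_zero.2 h.det_ne_zero)
  refine ⟨fun x => eval ![u x, w x] (C c⁻¹ * p), h.isPolyDeg_eval ?_, fun x => ?_⟩
  · refine (totalDegree_mul _ _).trans ?_
    simpa using hp
  · obtain ⟨f', hf', hv⟩ := h.hasFDerivAt_eval (C c⁻¹ * (X 1 * (1 - X 0 - X 1) * p)) x
    refine ⟨f', hf'.congr_of_eventuallyEq (.of_forall fun y => ?_), ?_⟩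
    · simp
      ring
    · rw [hv, pderiv_C_mul, ← hpq, hfq]
      simp [hc]

open MvPolynomial in
theorem exists_integral_mul_pow (h : IsChart y0 y1 y2 u w) {m : ℕ} (hm : 2 ≤ m) (α β : ℝ) :
    ∃ g : (Fin 2 → ℝ) → ℝ, IsPolyDeg m g ∧
      (∀ j ≤ m, ∫ x in Ktri y0 y1 y2, g x * u x ^ j = if j = m then α else 0) ∧
      (∀ j ≤ m, ∫ x in Ktri y0 y1 y2, g x * w x ^ j = if j = m then β else 0) ∧
      ∀ j ≤ m, ∫ x in Ktri y0 y1 y2, g x * (1 - u x - w x) ^ j = 0 := by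
  have hD := abs_ne_zero.2 h.det_ne_zero
  set D := |(Bmat y0 y1 y2).det| with hDdef
  obtain ⟨g, hg, h0, h1, h2⟩ := exists_refInt_mul_pow_eq m hm (α / D) (β / D)
  refine ⟨fun x => eval ![u x, w x] g, h.isPolyDeg_eval hg, fun j hj => ?_, fun j hj => ?_,
    fun j hj => ?_⟩
  · have := h.setIntegral_eval (g * X 0 ^ j)
    simp only [map_mul, map_pow, eval_X, Matrix.cons_val_zero] at this
    rw [this, h0 j hj]
    split_ifs <;> simp [← hDdef, mul_div_cancel₀ _ hD]
  · have := h.setIntegral_eval (g * X 1 ^ j)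
    simp only [map_mul, map_pow, eval_X, Matrix.cons_val_one, Matrix.cons_val_zero] at this
    rw [this, h1 j hj]
    split_ifs <;> simp [← hDdef, mul_div_cancel₀ _ hD]
  · have := h.setIntegral_eval (g * (1 - X 0 - X 1) ^ j)
    simp only [map_mul, map_pow, map_sub, map_one, eval_X, Matrix.cons_val_zero,
      Matrix.cons_val_one] at this
    rw [this, h2 j hj, mul_zero]

theorem third_eq (h : IsChart y0 y1 y2 u w) {l : (Fin 2 → ℝ) → ℝ} (hl : IsAffineFn l)
    (h0 : l y0 = 1) (h1 : l y1 = 0) (h2 : l y2 = 0) (x : Fin 2 → ℝ) : 1 - u x - w x = l x := by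
  have := hl.apply_triParam y0 y1 y2 ![u x, w x]
  rw [h.left_inv, h0, h1, h2] at this
  simpa using this.symm

end IsChart

theorem Ktri_rotate (x0 x1 x2 : Fin 2 → ℝ) : Ktri x1 x2 x0 = Ktri x0 x1 x2 := by
  unfold Ktri
  congr 1
  ext x
  simp only [Set.mem_insert_iff, Set.mem_singleton_iff]
  tauto

theorem perp_nvec (x0 x1 x2 : Fin 2 → ℝ) :
    perp (nvec x0 x1 x2 1) = (fun i => (Bmat x0 x1 x2).det⁻¹ * (x2 i - x0 i)) ∧
    perp (nvec x0 x1 x2 2) = (fun i => (Bmat x0 x1 x2).det⁻¹ * (x0 i - x1 i)) ∧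
    perp (nvec x0 x1 x2 0) = fun i => (Bmat x0 x1 x2).det⁻¹ * (x1 i - x2 i) := by
  refine ⟨?_, ?_, ?_⟩ <;> ext i <;> fin_cases i <;>
    simp [perp, nvec, Matrix.inv_def, Matrix.adjugate_fin_two, Bmat, Ring.inverse_eq_inv'] <;> ring

theorem matDiv_sum_smul_vvT {f : Fin 3 → (Fin 2 → ℝ) → ℝ} {t : Fin 3 → Fin 2 → ℝ}
    {f' : Fin 3 → (Fin 2 → ℝ) →L[ℝ] ℝ} {x : Fin 2 → ℝ}
    (hf : ∀ e, HasFDerivAt (f e) (f' e) x) (i : Fin 2) :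
    matDiv (fun y => f 1 y • vvT (t 1) + f 2 y • vvT (t 2) + f 0 y • vvT (t 0)) x i =
      f' 1 (t 1) * t 1 i + f' 2 (t 2) * t 2 i + f' 0 (t 0) * t 0 i := by
  have hpd (j : Fin 2) : pd j (fun y =>
      (f 1 y • vvT (t 1) + f 2 y • vvT (t 2) + f 0 y • vvT (t 0)) i j) x =
      f' 1 (Pi.single j 1) * (t 1 i * t 1 j) + f' 2 (Pi.single j 1) * (t 2 i * t 2 j)
        + f' 0 (Pi.single j 1) * (t 0 i * t 0 j) := by
    have h := (((hf 1).mul_const (t 1 i * t 1 j)).fun_add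
      ((hf 2).mul_const (t 2 i * t 2 j))).fun_add ((hf 0).mul_const (t 0 i * t 0 j))
    have heq : (fun y => (f 1 y • vvT (t 1) + f 2 y • vvT (t 2) + f 0 y • vvT (t 0)) i j) =
        fun y => f 1 y * (t 1 i * t 1 j) + f 2 y * (t 2 i * t 2 j) + f 0 y * (t 0 i * t 0 j) := by
      funext y
      simp [vvT]
    rw [pd, heq, h.fderiv]
    simp [mul_comm]
  have hlin (e : Fin 3) : f' e (t e) =
      t e 0 * f' e (Pi.single 0 1) + t e 1 * f' e (Pi.single 1 1) := by
    have ht : t e = t e 0 • Pi.single 0 1 + t e 1 • Pi.single 1 1 := by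
      ext j
      fin_cases j <;> simp
    conv_lhs => rw [ht]
    simp only [map_add, map_smul, smul_eq_mul]
  simp only [matDiv, hpd, hlin]
  ring

theorem stmt_11 (k : ℕ) (hk : 3 ≤ k)
    (x0 x1 x2 : Fin 2 → ℝ)
    (hind : AffineIndependent ℝ ![x0, x1, x2])
    (lam : Fin 3 → (Fin 2 → ℝ) → ℝ)
    (hlam_aff : ∀ i, IsAffineFn (lam i))
    (hlam_val : ∀ i j : Fin 3, lam i (![x0, x1, x2] j) = if i = j then 1 else 0)
    (v : (Fin 2 → ℝ) → Fin 2 → ℝ)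
    (hv : ∀ i, IsPolyDeg ((k : ℤ) - 1) (fun x => v x i))
    (horth : ∀ p : (Fin 2 → ℝ) → Fin 2 → ℝ,
      (∀ i, IsPolyDeg ((k : ℤ) - 2) (fun x => p x i)) →
      ∫ x in Ktri x0 x1 x2, ∑ i : Fin 2, v x i * p x i = 0) :
    ∃ τ, SigmaKb k x0 x1 x2 lam τ ∧ ∀ x, matDiv τ x = v x := by
  obtain ⟨m, rfl⟩ : ∃ m, k = m + 1 := ⟨k - 1, by omega⟩
  have hm : 2 ≤ m := by omega
  have hk1 : ((m + 1 : ℕ) : ℤ) - 1 = (m : ℕ) := by push_cast; ring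
  have hk2 : ((m + 1 : ℕ) : ℤ) - 2 = (m - 1 : ℕ) := by omega
  rw [hk1] at hv
  rw [hk2] at horth
  have hval (i : Fin 3) := hlam_val i
  simp only [Fin.forall_fin_succ, Fin.isValue] at hval
  simp at hval
  obtain ⟨⟨h00, h01, h02⟩, ⟨h10, h11, h12⟩, h20, h21, h22⟩ := hval
  have c1 : IsChart x0 x1 x2 (lam 1) (lam 2) :=
    ⟨hlam_aff 1, hlam_aff 2, h10, h11, h12, h20, h21, h22⟩
  have c2 : IsChart x1 x2 x0 (lam 2) (lam 0) :=
    ⟨hlam_aff 2, hlam_aff 0, h21, h22, h20, h01, h02, h00⟩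
  have c0 : IsChart x2 x0 x1 (lam 0) (lam 1) :=
    ⟨hlam_aff 0, hlam_aff 1, h02, h00, h01, h12, h10, h11⟩
  have e1 := c1.third_eq (hlam_aff 0) h00 h01 h02
  have e2 := c2.third_eq (hlam_aff 1) h11 h12 h10
  have e0 := c0.third_eq (hlam_aff 2) h22 h20 h21
  set K := Ktri x0 x1 x2 with hK
  have hK2 : Ktri x1 x2 x0 = K := Ktri_rotate x0 x1 x2
  have hK0 : Ktri x2 x0 x1 = K := (Ktri_rotate x2 x0 x1).symm
  have hKc : IsCompact K := (Set.toFinite {x0, x1, x2}).isCompact_convexHull ℝ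
  set d := (Bmat x0 x1 x2).det with hd
  have hd0 : d ≠ 0 := c1.det_ne_zero
  obtain ⟨t1, t2, t0⟩ := perp_nvec x0 x1 x2
  rw [← hd] at t1 t2 t0
  have hcomb (α β : ℝ) : IsPolyDeg m (fun x => α * v x 0 + β * v x 1) ∧
      ∀ q, IsPolyDeg (m - 1 : ℕ) q → ∫ x in K, (α * v x 0 + β * v x 1) * q x = 0 := by
    refine ⟨((hv 0).const_mul α).add ((hv 1).const_mul β), fun q hq => ?_⟩
    rw [← horth (fun x => ![α * q x, β * q x])
      (by intro i; fin_cases i <;> simpa using hq.const_mul _)]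
    congr 1
    funext x
    simp [Fin.sum_univ_two]
    ring
  set a : (Fin 2 → ℝ) → ℝ := fun x => -(x1 1 - x0 1) * v x 0 + (x1 0 - x0 0) * v x 1 with ha
  set b : (Fin 2 → ℝ) → ℝ := fun x => -(x2 1 - x0 1) * v x 0 + (x2 0 - x0 0) * v x 1 with hb
  obtain ⟨haP, haO⟩ : IsPolyDeg m a ∧
      ∀ q, IsPolyDeg (m - 1 : ℕ) q → ∫ x in K, a x * q x = 0 := hcomb _ _
  obtain ⟨hbP, hbO⟩ : IsPolyDeg m b ∧
      ∀ q, IsPolyDeg (m - 1 : ℕ) q → ∫ x in K, b x * q x = 0 := hcomb _ _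
  obtain ⟨g, hgP, hg1, hg2, hg0⟩ := c1.exists_integral_mul_pow hm
    (-∫ x in K, a x * lam 1 x ^ m) (-∫ x in K, b x * lam 2 x ^ m)
  simp only [e1] at hg0
  have hsum {f l : (Fin 2 → ℝ) → ℝ} (hf : IsPolyDeg m f) (hl : IsAffineFn l)
      (hO : ∀ q, IsPolyDeg (m - 1 : ℕ) q → ∫ x in K, f x * q x = 0)
      (hg : ∀ j ≤ m, ∫ x in K, g x * l x ^ j = if j = m then -∫ x in K, f x * l x ^ m else 0)
      (j : ℕ) (hj : j ≤ m) : ∫ x in K, (f x + g x) * l x ^ j = 0 := by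
    have hlc : Continuous fun x => l x ^ j := (hl.pow_isPolyDeg le_rfl).continuous
    simp only [add_mul]
    rw [integral_add ((hf.continuous.fun_mul hlc).continuousOn.integrableOn_compact hKc)
      ((hgP.continuous.fun_mul hlc).continuousOn.integrableOn_compact hKc), hg j hj]
    split_ifs with h
    · rw [h, add_neg_cancel]
    · rw [hO _ (hl.pow_isPolyDeg (by omega)), add_zero]
  have hdi : d⁻¹ ≠ 0 := inv_ne_zero hd0
  obtain ⟨p1, hp1, hf1⟩ := c1.exists_bubble (haP.add hgP) (hsum haP (hlam_aff 1) haO hg1) hdi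
  obtain ⟨p2, hp2, hf2⟩ := c2.exists_bubble (hbP.add hgP)
    (by rw [hK2]; exact hsum hbP (hlam_aff 2) hbO hg2) hdi
  obtain ⟨p0, hp0, hf0⟩ := c0.exists_bubble hgP (by rw [hK0]; exact hg0) hdi
  simp only [mul_assoc, e1] at hf1
  simp only [mul_assoc, e2] at hf2
  simp only [mul_assoc, e0] at hf0
  refine ⟨_, ⟨![p0, p1, p2], ?_, rfl⟩, fun x => ?_⟩
  · rw [hk2]
    intro i
    fin_cases i
    · exact hp0
    · exact hp1
    · exact hp2
  · obtain ⟨f1, hf1, hv1⟩ := hf1 x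
    obtain ⟨f2, hf2, hv2⟩ := hf2 x
    obtain ⟨f0, hf0, hv0⟩ := hf0 x
    have hder := matDiv_sum_smul_vvT (x := x) (t := fun e => perp (nvec x0 x1 x2 e))
      (f := ![fun y => lam 1 y * (lam 2 y * p0 y), fun y => lam 2 y * (lam 0 y * p1 y),
        fun y => lam 0 y * (lam 1 y * p2 y)]) (f' := ![f0, f1, f2])
      (by intro e; fin_cases e; exacts [hf0, hf1, hf2])
    have heq : bubbleStress x0 x1 x2 lam ![p0, p1, p2] = fun y =>
        (lam 2 y * (lam 0 y * p1 y)) • vvT (perp (nvec x0 x1 x2 1)) +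
        (lam 0 y * (lam 1 y * p2 y)) • vvT (perp (nvec x0 x1 x2 2)) +
        (lam 1 y * (lam 2 y * p0 y)) • vvT (perp (nvec x0 x1 x2 0)) := by
      funext y
      simp [bubbleStress, mul_assoc]
    ext i
    rw [heq]
    refine (hder i).trans ?_
    simp only [Matrix.cons_val_zero, Matrix.cons_val_one, Matrix.cons_val, t1, t2, t0, hv1, hv2,
      hv0]
    have hdet : d = (x1 0 - x0 0) * (x2 1 - x0 1) - (x2 0 - x0 0) * (x1 1 - x0 1) := by
      rw [hd, Matrix.det_fin_two]
      simp [Bmat]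
    simp only [ha, hb]
    field_simp
    rw [hdet]
    fin_cases i <;> simp <;> ring
end
end
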